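/- arXiv:1806.03206 — 2 statements merged into one kernel-verified Lean document; each statement's English description precedes it below -/
import Mathlib

section
/- Let P = (X, d, x̄) be a presentation of a Polish space X. (1) For every closed F ⊆ X, the set A_F^P is P-closed and P-pruned and F_{A_F^P}^P = F; conversely, for every P-closed and P-pruned set A ⊆ ω×ω, the set F_A^P is closed in X and A_{F_A^P}^P = A; hence F ↦ A_F^P is a bijection between the closed subsets of X and the P-closed, P-pruned subsets of ω×ω, with inverse A ↦ F_A^P. (2) A closed set F ⊆ X is perfect if and only if A_F^P is P-perfect. -/
open Set Filter Topology

/-- A presentation `(X, d, x̄)` of a Polish space `X`: a complete metric `d`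
compatible with the topology of `X`, together with a dense sequence `x̄`. -/
structure Presentation (X : Type) [TopologicalSpace X] where
  dist : X → X → ℝ
  seq : ℕ → X
  dist_self : ∀ x, dist x x = 0
  eq_of_dist_eq_zero : ∀ x y, dist x y = 0 → x = y
  dist_comm : ∀ x y, dist x y = dist y x
  dist_triangle : ∀ x y z, dist x z ≤ dist x y + dist y z
  /-- `d` is compatible with the topology of `X`. -/
  isOpen_iff : ∀ s : Set X, IsOpen s ↔ ∀ x ∈ s, ∃ ε > 0, ∀ y, dist y x < ε → y ∈ s
  /-- `d` is complete. -/
  complete : ∀ u : ℕ → X, (∀ ε > 0, ∃ N, ∀ m ≥ N, ∀ n ≥ N, dist (u m) (u n) < ε) →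
      ∃ x, ∀ ε > 0, ∃ N, ∀ n ≥ N, dist (u n) x < ε
  /-- the sequence `x̄` is dense. -/
  dense : ∀ x, ∀ ε > 0, ∃ i, dist x (seq i) < ε

namespace Presentation

variable {X : Type} [TopologicalSpace X] (P : Presentation X)

/-- The open ball `B_P(n)`. -/
def ball (n : ℕ × ℕ) : Set X := {x | P.dist x (P.seq n.1) < (1/2 : ℝ) ^ (n.2 + 1)}

/-- The closed ball `B̄_P(n)`. -/
def cball (n : ℕ × ℕ) : Set X := {x | P.dist x (P.seq n.1) ≤ (1/2 : ℝ) ^ (n.2 + 1)}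

/-- The relation `n ≺_P m`. -/
def prec (n m : ℕ × ℕ) : Prop := n.2 < m.2 ∧ P.cball m ⊆ P.ball n

/-- The relation `n ⋏_P m`. -/
def apart (n m : ℕ × ℕ) : Prop := P.cball n ∩ P.cball m = ∅

/-- The code `A_F^P` of a closed set `F ⊆ X`. -/
def code (F : Set X) : Set (ℕ × ℕ) := {n | (P.ball n ∩ F).Nonempty}

/-- The derivative `D_P` on subsets of `ω × ω`. -/
def deriv (A : Set (ℕ × ℕ)) : Set (ℕ × ℕ) :=
  {n ∈ A | ∃ u ∈ A, ∃ v ∈ A, P.prec n u ∧ P.prec n v ∧ P.apart u v}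

/-- The transfinite iterates `D_P^α(A)`. -/
noncomputable def derivIter (A : Set (ℕ × ℕ)) (α : Ordinal.{0}) : Set (ℕ × ℕ) :=
  Ordinal.limitRecOn α A (fun _ ih => P.deriv ih)
    (fun o _ ih => ⋂ (β : {β : Ordinal.{0} // β < o}), ih β.1 β.2)

/-- The rank `|A|_P`: the least ordinal `α` with `D_P^α(A) = D_P^{α+1}(A)`. -/
noncomputable def rankA (A : Set (ℕ × ℕ)) : Ordinal.{0} :=
  sInf {α | P.derivIter A (α + 1) = P.derivIter A α}

/-- The rank `φ_P(F) = |A_F^P|_P` of a (countable closed) subset `F ⊆ X`. -/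
noncomputable def phi (F : Set X) : Ordinal.{0} := P.rankA (P.code F)

/-- `A ⊆ ω × ω` is `P`-closed. -/
def PClosed (A : Set (ℕ × ℕ)) : Prop := ∀ n ∈ A, ∀ m, P.prec m n → m ∈ A

/-- `A ⊆ ω × ω` is `P`-pruned. -/
def PPruned (A : Set (ℕ × ℕ)) : Prop := ∀ n ∈ A, ∃ m ∈ A, P.prec n m

/-- `A ⊆ ω × ω` is `P`-perfect. -/
def PPerfect (A : Set (ℕ × ℕ)) : Prop :=
  ∀ n ∈ A, ∃ u ∈ A, ∃ v ∈ A, P.prec n u ∧ P.prec n v ∧ P.apart u v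

/-- The set `[A]_P` of `P`-compatible sequences lying in `A`. -/
def body (A : Set (ℕ × ℕ)) : Set (ℕ → ℕ × ℕ) :=
  {f | (∀ i, P.prec (f i) (f (i + 1))) ∧ ∀ i, f i ∈ A}

/-- The set `F_A^P = π_P([A]_P)`: the points obtained as the unique point of
`⋂_i B_P(n_i)` for a `P`-compatible sequence `(n_i)` in `A`. -/
def limitSet (A : Set (ℕ × ℕ)) : Set X :=
  {x | ∃ f ∈ P.body A, ∀ i, x ∈ P.ball (f i)}

end Presentation

section CB

variable {X : Type} [TopologicalSpace X]

/-- The Cantor–Bendixson derivative: the set of limit points of `F` in `F`. -/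
def cbDeriv (F : Set X) : Set X := {x ∈ F | AccPt x (𝓟 F)}

/-- The iterated Cantor–Bendixson derivatives `F^α`. -/
noncomputable def cbIter (F : Set X) (α : Ordinal.{0}) : Set X :=
  Ordinal.limitRecOn α F (fun _ ih => cbDeriv ih)
    (fun o _ ih => ⋂ (β : {β : Ordinal.{0} // β < o}), ih β.1 β.2)

/-- The Cantor–Bendixson rank `|F|_CB`. -/
noncomputable def cbRank (F : Set X) : Ordinal.{0} :=
  sInf {α | cbIter F (α + 1) = cbIter F α}

/-- The `K_σ`-derivative of a subset `A ⊆ X`: the points of `A` having no open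
neighborhood in the subspace `A` whose closure in `A` is compact. -/
def kDeriv (A : Set X) : Set X :=
  {x ∈ A | ∀ U : Set X, IsOpen U → x ∈ U → ¬ IsCompact (A ∩ closure (U ∩ A))}

/-- The iterated `K_σ`-derivatives `X_α` of the space `X`. -/
noncomputable def kIter (X : Type) [TopologicalSpace X] (α : Ordinal.{0}) : Set X :=
  Ordinal.limitRecOn α Set.univ (fun _ ih => kDeriv ih)
    (fun o _ ih => ⋂ (β : {β : Ordinal.{0} // β < o}), ih β.1 β.2)

/-- The `K_σ`-rank `|X|_{K_σ}`. -/
noncomputable def kRank (X : Type) [TopologicalSpace X] : Ordinal.{0} :=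
  sInf {α | kIter X (α + 1) = kIter X α}

end CB

namespace Presentation

variable {X : Type} [TopologicalSpace X] (P : Presentation X)

lemma mem_ball {n : ℕ × ℕ} {x : X} :
    x ∈ P.ball n ↔ P.dist x (P.seq n.1) < (1 / 2 : ℝ) ^ (n.2 + 1) := Iff.rfl

lemma mem_cball {n : ℕ × ℕ} {x : X} :
    x ∈ P.cball n ↔ P.dist x (P.seq n.1) ≤ (1 / 2 : ℝ) ^ (n.2 + 1) := Iff.rfl

lemma ball_subset_cball (n : ℕ × ℕ) : P.ball n ⊆ P.cball n := fun _ hx =>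
  P.mem_cball.2 (P.mem_ball.1 hx).le

lemma isOpen_ball (n : ℕ × ℕ) : IsOpen (P.ball n) := by
  refine (P.isOpen_iff _).2 fun x hx =>
    ⟨(1 / 2 : ℝ) ^ (n.2 + 1) - P.dist x (P.seq n.1), sub_pos.2 (P.mem_ball.1 hx), fun y hy => ?_⟩
  have := P.dist_triangle y x (P.seq n.1)
  rw [mem_ball]
  linarith

lemma seq_mem_cball (n : ℕ × ℕ) : P.seq n.1 ∈ P.cball n := by
  rw [mem_cball, P.dist_self]
  positivity

lemma dist_le_of_mem_cball {n : ℕ × ℕ} {x y : X} (hx : x ∈ P.cball n) (hy : y ∈ P.cball n) :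
    P.dist x y ≤ (1 / 2 : ℝ) ^ n.2 := by
  have h := P.dist_triangle x (P.seq n.1) y
  rw [P.dist_comm (P.seq n.1) y] at h
  rw [mem_cball, pow_succ] at hx hy
  linarith

/-- All sufficiently small closed balls around a point of an open set lie in that set. -/
lemma exists_forall_cball_subset {U : Set X} (hU : IsOpen U) {x : X} (hx : x ∈ U) :
    ∃ N, ∀ m : ℕ × ℕ, N ≤ m.2 → x ∈ P.ball m → P.cball m ⊆ U := by
  obtain ⟨ε, hε, h⟩ := (P.isOpen_iff U).1 hU x hx
  obtain ⟨N, hN⟩ := exists_pow_lt_of_lt_one hε (by norm_num : (1 / 2 : ℝ) < 1)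
  refine ⟨N, fun m hm hxm y hy => h y ?_⟩
  calc P.dist y x ≤ (1 / 2 : ℝ) ^ m.2 := P.dist_le_of_mem_cball hy (P.ball_subset_cball m hxm)
    _ ≤ (1 / 2 : ℝ) ^ N := pow_le_pow_of_le_one (by norm_num) (by norm_num) hm
    _ < ε := hN

lemma exists_mem_ball (x : X) (k : ℕ) : ∃ m : ℕ × ℕ, m.2 = k ∧ x ∈ P.ball m := by
  obtain ⟨i, hi⟩ := P.dense x ((1 / 2 : ℝ) ^ (k + 1)) (by positivity)
  exact ⟨(i, k), rfl, hi⟩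

lemma exists_cball_subset {U : Set X} (hU : IsOpen U) {x : X} (hx : x ∈ U) (k : ℕ) :
    ∃ m : ℕ × ℕ, k < m.2 ∧ x ∈ P.ball m ∧ P.cball m ⊆ U := by
  obtain ⟨N, hN⟩ := P.exists_forall_cball_subset hU hx
  obtain ⟨m, hm, hxm⟩ := P.exists_mem_ball x (max N (k + 1))
  exact ⟨m, by omega, hxm, hN m (by omega) hxm⟩

lemma exists_prec_of_mem_ball {x : X} {n : ℕ × ℕ} (hx : x ∈ P.ball n) :
    ∃ m, x ∈ P.ball m ∧ P.prec n m := by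
  obtain ⟨m, hm, hxm, hs⟩ := P.exists_cball_subset (P.isOpen_ball n) hx n.2
  exact ⟨m, hxm, hm, hs⟩

lemma PPruned.exists_body {P : Presentation X} {A : Set (ℕ × ℕ)} (hA : P.PPruned A)
    {n : ℕ × ℕ} (hn : n ∈ A) : ∃ f ∈ P.body A, f 0 = n := by
  choose! g hgA hg using hA
  have hmem : ∀ i, g^[i] n ∈ A := fun i => by
    induction i with
    | zero => exact hn
    | succ i ih => rw [Function.iterate_succ_apply']; exact hgA _ ih
  refine ⟨fun i => g^[i] n, ⟨fun i => ?_, hmem⟩, rfl⟩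
  simpa only [Function.iterate_succ_apply'] using hg _ (hmem i)

lemma mem_limitSet_of_forall {A : Set (ℕ × ℕ)} {x : X} (h : ∀ n, x ∈ P.ball n → n ∈ A) :
    x ∈ P.limitSet A := by
  have hp : P.PPruned {n | x ∈ P.ball n} := fun n hn => P.exists_prec_of_mem_ball hn
  obtain ⟨n, -, hn⟩ := P.exists_mem_ball x 0
  obtain ⟨f, ⟨hf, hfx⟩, -⟩ := hp.exists_body hn
  exact ⟨f, ⟨hf, fun i => h _ (hfx i)⟩, hfx⟩

lemma le_snd_of_mem_body {A : Set (ℕ × ℕ)} {f : ℕ → ℕ × ℕ} (hf : f ∈ P.body A) (i : ℕ) :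
    i ≤ (f i).2 := by
  induction i with
  | zero => exact Nat.zero_le _
  | succ i ih => exact ih.trans_lt (hf.1 i).1

lemma antitone_cball {A : Set (ℕ × ℕ)} {f : ℕ → ℕ × ℕ} (hf : f ∈ P.body A) :
    Antitone fun i => P.cball (f i) :=
  antitone_nat_of_succ_le fun i => (hf.1 i).2.trans (P.ball_subset_cball _)

/-- A compatible sequence of balls has a common point, by completeness. -/
lemma exists_forall_mem_ball {A : Set (ℕ × ℕ)} {f : ℕ → ℕ × ℕ} (hf : f ∈ P.body A) :
    ∃ x, ∀ i, x ∈ P.ball (f i) := by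
  have hmem : ∀ {n m}, n ≤ m → P.seq (f m).1 ∈ P.cball (f n) := fun h =>
    P.antitone_cball hf h (P.seq_mem_cball _)
  obtain ⟨x, hx⟩ := P.complete (fun i => P.seq (f i).1) fun ε hε => by
    obtain ⟨N, hN⟩ := exists_pow_lt_of_lt_one hε (by norm_num : (1 / 2 : ℝ) < 1)
    refine ⟨N, fun m hm n hn => ?_⟩
    calc P.dist (P.seq (f m).1) (P.seq (f n).1) ≤ (1 / 2 : ℝ) ^ (f N).2 :=
          P.dist_le_of_mem_cball (hmem hm) (hmem hn)
      _ ≤ (1 / 2 : ℝ) ^ N :=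
          pow_le_pow_of_le_one (by norm_num) (by norm_num) (P.le_snd_of_mem_body hf N)
      _ < ε := hN
  refine ⟨x, fun i => (hf.1 i).2 (P.mem_cball.2 (le_of_forall_pos_le_add fun ε hε => ?_))⟩
  obtain ⟨N, hN⟩ := hx ε hε
  have h₁ := hN (max N (i + 1)) (le_max_left _ _)
  have h₂ := hmem (le_max_right N (i + 1))
  have h₃ := P.dist_triangle x (P.seq (f (max N (i + 1))).1) (P.seq (f (i + 1)).1)
  rw [P.dist_comm x (P.seq (f (max N (i + 1))).1)] at h₃
  rw [mem_cball] at h₂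
  linarith

lemma exists_mem_cball_subset_of_mem_limitSet {A : Set (ℕ × ℕ)} {x : X}
    (hx : x ∈ P.limitSet A) {U : Set X} (hU : IsOpen U) (hxU : x ∈ U) (k : ℕ) :
    ∃ m ∈ A, k < m.2 ∧ P.cball m ⊆ U := by
  obtain ⟨f, hf, hxf⟩ := hx
  obtain ⟨N, hN⟩ := P.exists_forall_cball_subset hU hxU
  have := P.le_snd_of_mem_body hf (max N (k + 1))
  exact ⟨f (max N (k + 1)), hf.2 _, by omega, hN _ (by omega) (hxf _)⟩

lemma pClosed_code (F : Set X) : P.PClosed (P.code F) := fun n ⟨x, hxn, hxF⟩ _ hm =>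
  ⟨x, hm.2 (P.ball_subset_cball n hxn), hxF⟩

lemma pPruned_code (F : Set X) : P.PPruned (P.code F) := fun n ⟨x, hxn, hxF⟩ => by
  obtain ⟨m, hxm, hm⟩ := P.exists_prec_of_mem_ball hxn
  exact ⟨m, ⟨x, hxm, hxF⟩, hm⟩

lemma limitSet_code {F : Set X} (hF : IsClosed F) : P.limitSet (P.code F) = F := by
  refine Set.Subset.antisymm (fun x hx => ?_) fun x hx =>
    P.mem_limitSet_of_forall fun n hn => ⟨x, hn, hx⟩
  by_contra hxF
  obtain ⟨m, ⟨y, hym, hyF⟩, -, hm⟩ :=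
    P.exists_mem_cball_subset_of_mem_limitSet hx hF.isOpen_compl hxF 0
  exact hm (P.ball_subset_cball m hym) hyF

lemma code_limitSet {A : Set (ℕ × ℕ)} (hc : P.PClosed A) (hp : P.PPruned A) :
    P.code (P.limitSet A) = A := by
  refine Set.Subset.antisymm (fun n ⟨x, hxn, hx⟩ => ?_) fun n hn => ?_
  · obtain ⟨m, hmA, hk, hm⟩ :=
      P.exists_mem_cball_subset_of_mem_limitSet hx (P.isOpen_ball n) hxn n.2
    exact hc m hmA n ⟨hk, hm⟩
  · obtain ⟨f, hf, rfl⟩ := hp.exists_body hn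
    obtain ⟨x, hx⟩ := P.exists_forall_mem_ball hf
    exact ⟨x, hx 0, f, hf, hx⟩

lemma isClosed_limitSet {A : Set (ℕ × ℕ)} (hc : P.PClosed A) (hp : P.PPruned A) :
    IsClosed (P.limitSet A) := by
  refine isClosed_of_closure_subset fun x hx => P.mem_limitSet_of_forall fun n hn => ?_
  rw [← P.code_limitSet hc hp]
  exact mem_closure_iff.1 hx _ (P.isOpen_ball n) hn

lemma pPerfect_code_of_preperfect [T2Space X] {F : Set X} (hF : Preperfect F) :
    P.PPerfect (P.code F) := by
  rintro n ⟨x, hxn, hxF⟩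
  obtain ⟨y, ⟨hyn, hyF⟩, hyx⟩ :=
    accPt_iff_nhds.1 (hF x hxF) _ ((P.isOpen_ball n).mem_nhds hxn)
  obtain ⟨U, V, hU, hV, hyU, hxV, hUV⟩ := t2_separation hyx
  obtain ⟨u, hku, hyu, hu⟩ :=
    P.exists_cball_subset (hU.inter (P.isOpen_ball n)) ⟨hyU, hyn⟩ n.2
  obtain ⟨v, hkv, hxv, hv⟩ :=
    P.exists_cball_subset (hV.inter (P.isOpen_ball n)) ⟨hxV, hxn⟩ n.2
  exact ⟨u, ⟨y, hyu, hyF⟩, v, ⟨x, hxv, hxF⟩, ⟨hku, hu.trans inter_subset_right⟩,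
    ⟨hkv, hv.trans inter_subset_right⟩,
    (hUV.mono (hu.trans inter_subset_left) (hv.trans inter_subset_left)).inter_eq⟩

lemma preperfect_of_pPerfect_code {F : Set X} (h : P.PPerfect (P.code F)) : Preperfect F := by
  refine fun x hxF => accPt_iff_nhds.2 fun W hW => ?_
  obtain ⟨U, hUW, hU, hxU⟩ := mem_nhds_iff.1 hW
  obtain ⟨n, -, hxn, hn⟩ := P.exists_cball_subset hU hxU 0
  obtain ⟨u, ⟨y, hyu, hyF⟩, v, ⟨z, hzv, hzF⟩, hu, hv, huv⟩ := h n ⟨x, hxn, hxF⟩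
  have hW' : ∀ {m w}, P.prec n m → w ∈ P.ball m → w ∈ W := fun hm hw =>
    hUW (hn (P.ball_subset_cball _ (hm.2 (P.ball_subset_cball _ hw))))
  by_cases hyx : y = x
  · refine ⟨z, ⟨hW' hv hzv, hzF⟩, fun hzx => ?_⟩
    have hy : y ∈ P.cball u ∩ P.cball v :=
      ⟨P.ball_subset_cball u hyu, hyx ▸ hzx ▸ P.ball_subset_cball v hzv⟩
    rw [apart] at huv
    simp [huv] at hy
  · exact ⟨y, ⟨hW' hu hyu, hyF⟩, hyx⟩

end Presentation

/-- `F ↦ A_F^P` is a bijection between closed subsets of `X` and the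
`P`-closed, `P`-pruned subsets of `ω × ω`, with inverse `A ↦ F_A^P`; moreover a closed
set `F` is perfect iff `A_F^P` is `P`-perfect. -/
theorem stmt6 {X : Type} [TopologicalSpace X] [PolishSpace X] (P : Presentation X) :
    (∀ F : Set X, IsClosed F →
      P.PClosed (P.code F) ∧ P.PPruned (P.code F) ∧ P.limitSet (P.code F) = F) ∧
    (∀ A : Set (ℕ × ℕ), P.PClosed A → P.PPruned A →
      IsClosed (P.limitSet A) ∧ P.code (P.limitSet A) = A) ∧
    (∀ F : Set X, IsClosed F → (Perfect F ↔ P.PPerfect (P.code F))) := by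
  exact ⟨fun F hF => ⟨P.pClosed_code F, P.pPruned_code F, P.limitSet_code hF⟩,
    fun A hc hp => ⟨P.isClosed_limitSet hc hp, P.code_limitSet hc hp⟩,
    fun F hF => ⟨fun h => P.pPerfect_code_of_preperfect h.acc,
      fun h => ⟨hF, P.preperfect_of_pPerfect_code h⟩⟩⟩
end

section
/- Let X be a Polish space and let d be a complete compatible ultrametric on X. Then any pair of presentations P = (X, d, x̄) and S = (X, d, ȳ) with the same metric d (but possibly different dense sequences) satisfies φ_P(F) = φ_S(F) for every countable closed F ⊆ X. -/
open Set Filter Topology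

namespace Presentation

variable {X : Type} [TopologicalSpace X]

/-- `n` and `m` have the same radius index and code the same open and closed balls in the
presentations `P` and `S`. -/
def SameBalls (P S : Presentation X) (n m : ℕ × ℕ) : Prop :=
  n.2 = m.2 ∧ P.ball n = S.ball m ∧ P.cball n = S.cball m

variable {P S : Presentation X}

theorem SameBalls.symm {n m : ℕ × ℕ} (h : SameBalls P S n m) : SameBalls S P m n :=
  ⟨h.1.symm, h.2.1.symm, h.2.2.symm⟩

theorem SameBalls.prec {n m u v : ℕ × ℕ} (h : SameBalls P S n m) (h' : SameBalls P S u v)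
    (hp : P.prec n u) : S.prec m v := by
  unfold Presentation.prec at *
  rwa [← h.1, ← h'.1, ← h.2.1, ← h'.2.2]

theorem SameBalls.apart {n m u v : ℕ × ℕ} (h : SameBalls P S n m) (h' : SameBalls P S u v)
    (hp : P.apart n u) : S.apart m v := by
  unfold Presentation.apart at *
  rwa [← h.2.2, ← h'.2.2]

theorem exists_sameBalls (hPS : S.dist = P.dist)
    (hult : ∀ x y z, P.dist x z ≤ max (P.dist x y) (P.dist y z)) (n : ℕ × ℕ) :
    ∃ m, SameBalls P S n m := by
  obtain ⟨j, hj⟩ := S.dense (P.seq n.1) ((1 / 2 : ℝ) ^ (n.2 + 1)) (by positivity)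
  rw [hPS] at hj
  have hj' := hj
  rw [P.dist_comm] at hj'
  refine ⟨(j, n.2), rfl, ?_, ?_⟩
  · ext x
    simp only [ball, mem_ofPred_eq, hPS]
    exact ⟨fun h => (hult _ _ _).trans_lt (max_lt h hj),
      fun h => (hult _ _ _).trans_lt (max_lt h hj')⟩
  · ext x
    simp only [cball, mem_ofPred_eq, hPS]
    exact ⟨fun h => (hult _ _ _).trans (max_le h hj.le),
      fun h => (hult _ _ _).trans (max_le h hj'.le)⟩

theorem deriv_of_sameBalls (htot : ∀ n, ∃ m, SameBalls P S n m) {A B : Set (ℕ × ℕ)}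
    (hAB : ∀ n m, SameBalls P S n m → (n ∈ A ↔ m ∈ B)) {n m : ℕ × ℕ}
    (h : SameBalls P S n m) (hn : n ∈ P.deriv A) : m ∈ S.deriv B := by
  obtain ⟨hnA, u, hu, v, hv, hnu, hnv, huv⟩ := hn
  obtain ⟨u', hu'⟩ := htot u
  obtain ⟨v', hv'⟩ := htot v
  exact ⟨(hAB _ _ h).1 hnA, u', (hAB _ _ hu').1 hu, v', (hAB _ _ hv').1 hv,
    h.prec hu' hnu, h.prec hv' hnv, hu'.apart hv' huv⟩

theorem derivIter_zero (P : Presentation X) (A : Set (ℕ × ℕ)) : P.derivIter A 0 = A :=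
  Ordinal.limitRecOn_zero ..

theorem derivIter_add_one (P : Presentation X) (A : Set (ℕ × ℕ)) (α : Ordinal.{0}) :
    P.derivIter A (α + 1) = P.deriv (P.derivIter A α) :=
  Ordinal.limitRecOn_add_one ..

theorem derivIter_limit (P : Presentation X) (A : Set (ℕ × ℕ)) {α : Ordinal.{0}}
    (hα : Order.IsSuccLimit α) :
    P.derivIter A α = ⋂ β : {β : Ordinal.{0} // β < α}, P.derivIter A β.1 :=
  Ordinal.limitRecOn_limit _ _ _ _ hα

theorem mem_derivIter_iff_of_sameBalls (hPS : ∀ n, ∃ m, SameBalls P S n m)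
    (hSP : ∀ n, ∃ m, SameBalls S P n m) {A B : Set (ℕ × ℕ)}
    (hAB : ∀ n m, SameBalls P S n m → (n ∈ A ↔ m ∈ B)) (α : Ordinal.{0}) :
    ∀ n m, SameBalls P S n m → (n ∈ P.derivIter A α ↔ m ∈ S.derivIter B α) := by
  induction α using Ordinal.limitRecOn with
  | zero => simpa only [derivIter_zero] using hAB
  | add_one α ih =>
    intro n m h
    rw [derivIter_add_one, derivIter_add_one]
    exact ⟨deriv_of_sameBalls hPS ih h,
      deriv_of_sameBalls hSP (fun a b hab => (ih b a hab.symm).symm) h.symm⟩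
  | limit α hα ih =>
    intro n m h
    rw [derivIter_limit _ _ hα, derivIter_limit _ _ hα, mem_iInter, mem_iInter]
    exact forall_congr' fun β => ih β.1 β.2 n m h

theorem eq_of_sameBalls (hSP : ∀ n, ∃ m, SameBalls S P n m) {A A' B B' : Set (ℕ × ℕ)}
    (h : ∀ n m, SameBalls P S n m → (n ∈ A ↔ m ∈ B))
    (h' : ∀ n m, SameBalls P S n m → (n ∈ A' ↔ m ∈ B')) (hA : A = A') : B = B' := by
  ext m
  obtain ⟨n, hn⟩ := hSP m
  rw [← h n m hn.symm, ← h' n m hn.symm, hA]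

theorem rankA_eq_of_sameBalls (hPS : ∀ n, ∃ m, SameBalls P S n m)
    (hSP : ∀ n, ∃ m, SameBalls S P n m) {A B : Set (ℕ × ℕ)}
    (hAB : ∀ n m, SameBalls P S n m → (n ∈ A ↔ m ∈ B)) : P.rankA A = S.rankA B := by
  have key := mem_derivIter_iff_of_sameBalls hPS hSP hAB
  have key' (α) (a b) (hab : SameBalls S P a b) := (key α b a hab.symm).symm
  unfold rankA
  congr 1
  ext α
  exact ⟨eq_of_sameBalls hSP (key _) (key _), eq_of_sameBalls hPS (key' _) (key' _)⟩

end Presentation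

/-- If `d` is a complete compatible ultrametric on `X`, then any two
presentations with metric `d` give the same rank on countable closed sets. -/
theorem stmt8 {X : Type} [TopologicalSpace X] [PolishSpace X]
    (P S : Presentation X) (hPS : S.dist = P.dist)
    (hult : ∀ x y z, P.dist x z ≤ max (P.dist x y) (P.dist y z))
    (F : Set X) (hF : IsClosed F) (hcnt : F.Countable) :
    P.phi F = S.phi F := by
  refine Presentation.rankA_eq_of_sameBalls (Presentation.exists_sameBalls hPS hult)
    (Presentation.exists_sameBalls hPS.symm (hPS ▸ hult)) fun n m h => ?_
  simp only [Presentation.code, mem_ofPred_eq, h.2.1]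
end
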